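/- arXiv:1807.03263 — 4 statements merged into one kernel-verified Lean document; each statement's English description precedes it below -/
import Mathlib

section
/- For every integer N ≥ 0, the finite-horizon Riccati iterate satisfies the closed-form (batch) expression P_N = O_{N+1}^T (Q_{N+1}^{-1} + S_{N+1} R_{N+1}^{-1} S_{N+1}^T)^{-1} O_{N+1}, where the matrix Q_{N+1}^{-1} + S_{N+1} R_{N+1}^{-1} S_{N+1}^T is symmetric positive definite (hence invertible). -/
open Matrix

/-- Extended observability matrix `O_N` with `i`-th block row `C * A ^ i` (0-based). -/
def obsMat {n q : ℕ} (A : Matrix (Fin n) (Fin n) ℝ) (C : Matrix (Fin q) (Fin n) ℝ)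
    (N : ℕ) : Matrix (Fin N × Fin q) (Fin n) ℝ :=
  fun ia j => (C * A ^ (ia.1 : ℕ)) ia.2 j

/-- Block lower-triangular Toeplitz matrix `S_N` of Markov parameters: block `(i,j)` equals
`C * A ^ (i - j - 1) * B` for `i > j` (0-based), and `0` otherwise. -/
def toepMat {n p q : ℕ} (A : Matrix (Fin n) (Fin n) ℝ) (B : Matrix (Fin n) (Fin p) ℝ)
    (C : Matrix (Fin q) (Fin n) ℝ) (N : ℕ) : Matrix (Fin N × Fin q) (Fin N × Fin p) ℝ :=
  fun ia jb =>
    if (jb.1 : ℕ) < (ia.1 : ℕ) then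
      (C * A ^ ((ia.1 : ℕ) - (jb.1 : ℕ) - 1) * B) ia.2 jb.2
    else 0

/-- Block diagonal matrix `diag(Q, …, Q)` with `N` diagonal blocks. -/
def blkDiag {q : ℕ} (Q : Matrix (Fin q) (Fin q) ℝ) (N : ℕ) :
    Matrix (Fin N × Fin q) (Fin N × Fin q) ℝ :=
  fun ia jb => if ia.1 = jb.1 then Q ia.2 jb.2 else 0

/-- Splitting off the first block of a block index. -/
def blockSucc (N m : ℕ) : Fin m ⊕ Fin N × Fin m ≃ Fin (N + 1) × Fin m where
  toFun := Sum.elim (fun a => (0, a)) (fun ia => (ia.1.succ, ia.2))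
  invFun ia := Fin.cases (motive := fun _ => Fin m ⊕ Fin N × Fin m) (Sum.inl ia.2)
    (fun i => Sum.inr (i, ia.2)) ia.1
  left_inv := by rintro (a | ⟨i, a⟩) <;> simp
  right_inv := by
    rintro ⟨i, a⟩
    refine Fin.cases ?_ (fun i => ?_) i <;> simp

theorem obsMat_succ {n q : ℕ} (A : Matrix (Fin n) (Fin n) ℝ) (C : Matrix (Fin q) (Fin n) ℝ)
    (N : ℕ) :
    (obsMat A C (N + 1)).submatrix (blockSucc N q) id = fromRows C (obsMat A C N * A) := by
  have key (k : ℕ) (a : Fin q) (j : Fin n) :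
      (C * A ^ (k + 1)) a j = ∑ l, (C * A ^ k) a l * A l j := by
    rw [pow_succ, ← Matrix.mul_assoc, Matrix.mul_apply]
  ext (a | ⟨i, a⟩) j
  · simp [obsMat, blockSucc]
  · simp [obsMat, blockSucc, key, Matrix.mul_apply (N := A)]

theorem toepMat_succ {n p q : ℕ} (A : Matrix (Fin n) (Fin n) ℝ)
    (B : Matrix (Fin n) (Fin p) ℝ) (C : Matrix (Fin q) (Fin n) ℝ) (N : ℕ) :
    (toepMat A B C (N + 1)).submatrix (blockSucc N q) (blockSucc N p) =
      fromBlocks 0 0 (obsMat A C N * B) (toepMat A B C N) := by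
  ext (a | ⟨i, a⟩) (b | ⟨j, b⟩)
  · simp [toepMat, blockSucc]
  · simp [toepMat, blockSucc]
  · simp [toepMat, blockSucc, obsMat, Matrix.mul_apply (N := B)]
  · simp [toepMat, blockSucc]

theorem blkDiag_succ {q : ℕ} (Q : Matrix (Fin q) (Fin q) ℝ) (N : ℕ) :
    (blkDiag Q (N + 1)).submatrix (blockSucc N q) (blockSucc N q) =
      fromBlocks Q 0 0 (blkDiag Q N) := by
  ext (a | ⟨i, a⟩) (b | ⟨j, b⟩) <;>
    simp [blkDiag, blockSucc, Fin.succ_ne_zero, (Fin.succ_ne_zero _).symm]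

theorem blkDiag_eq_kronecker {q : ℕ} (Q : Matrix (Fin q) (Fin q) ℝ) (N : ℕ) :
    blkDiag Q N = kroneckerMap (· * ·) (1 : Matrix (Fin N) (Fin N) ℝ) Q := by
  ext ⟨i, a⟩ ⟨j, b⟩
  simp [blkDiag, Matrix.one_apply]

theorem blkDiag_inv {q : ℕ} (Q : Matrix (Fin q) (Fin q) ℝ) (N : ℕ) :
    (blkDiag Q N)⁻¹ = blkDiag Q⁻¹ N := by
  simp only [blkDiag_eq_kronecker, inv_kronecker, inv_one]

theorem posDef_blkDiag {q : ℕ} {Q : Matrix (Fin q) (Fin q) ℝ} (hQ : Q.PosDef) (N : ℕ) :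
    (blkDiag Q N).PosDef := by
  rw [blkDiag_eq_kronecker]
  exact PosDef.one.kronecker hQ

/-- The matrix inverted in the batch form of the Riccati recursion. -/
noncomputable def batchMat {n p q : ℕ} (A : Matrix (Fin n) (Fin n) ℝ) (B : Matrix (Fin n) (Fin p) ℝ)
    (C : Matrix (Fin q) (Fin n) ℝ) (Q : Matrix (Fin q) (Fin q) ℝ) (R : Matrix (Fin p) (Fin p) ℝ)
    (N : ℕ) : Matrix (Fin N × Fin q) (Fin N × Fin q) ℝ :=
  (blkDiag Q N)⁻¹ + toepMat A B C N * (blkDiag R N)⁻¹ * (toepMat A B C N)ᵀ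

section BatchMat

variable {n p q : ℕ} (A : Matrix (Fin n) (Fin n) ℝ) (B : Matrix (Fin n) (Fin p) ℝ)
  (C : Matrix (Fin q) (Fin n) ℝ) {Q : Matrix (Fin q) (Fin q) ℝ} {R : Matrix (Fin p) (Fin p) ℝ}

theorem posDef_batchMat (hQ : Q.PosDef) (hR : R.PosDef) (N : ℕ) :
    (batchMat A B C Q R N).PosDef := by
  refine (posDef_blkDiag hQ N).inv.add_posSemidef ?_
  simpa using (posDef_blkDiag hR N).inv.posSemidef.mul_mul_conjTranspose_same (toepMat A B C N)

theorem batchMat_succ (N : ℕ) :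
    (batchMat A B C Q R (N + 1)).submatrix (blockSucc N q) (blockSucc N q) =
      fromBlocks Q⁻¹ 0 0
        (batchMat A B C Q R N + obsMat A C N * B * R⁻¹ * (obsMat A C N * B)ᵀ) := by
  have hS : (toepMat A B C (N + 1) * blkDiag R⁻¹ (N + 1) * (toepMat A B C (N + 1))ᵀ).submatrix
      (blockSucc N q) (blockSucc N q) =
      fromBlocks 0 0 (obsMat A C N * B) (toepMat A B C N) * fromBlocks R⁻¹ 0 0 (blkDiag R⁻¹ N) *
        (fromBlocks 0 0 (obsMat A C N * B) (toepMat A B C N))ᵀ := by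
    rw [← toepMat_succ, ← blkDiag_succ, transpose_submatrix, submatrix_mul_equiv,
      submatrix_mul_equiv]
  simp only [batchMat, blkDiag_inv, submatrix_add, Pi.add_apply, blkDiag_succ, hS]
  simp only [fromBlocks_transpose, fromBlocks_multiply, fromBlocks_add]
  congr 1 <;> simp [add_comm, add_left_comm]

theorem batch_riccati_step (hQ : Q.PosDef) (hR : R.PosDef) (N : ℕ) (G : Matrix (Fin n) (Fin n) ℝ)
    (hG : G = (obsMat A C N)ᵀ * (batchMat A B C Q R N)⁻¹ * obsMat A C N) :
    (obsMat A C (N + 1))ᵀ * (batchMat A B C Q R (N + 1))⁻¹ * obsMat A C (N + 1) =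
      Aᵀ * G * A - (Aᵀ * G * B) * (R + Bᵀ * G * B)⁻¹ * (Bᵀ * G * A) + Cᵀ * Q * C := by
  have hW := posDef_batchMat A B C hQ hR N
  have hG0 : G.PosSemidef := by
    rw [hG]
    simpa using hW.inv.posSemidef.conjTranspose_mul_mul_same (obsMat A C N)
  have hK : (R + Bᵀ * G * B).PosDef := by
    refine hR.add_posSemidef ?_
    simpa using hG0.conjTranspose_mul_mul_same B
  have hK' : R⁻¹⁻¹ + (obsMat A C N * B)ᵀ * (batchMat A B C Q R N)⁻¹ * (obsMat A C N * B) =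
      R + Bᵀ * G * B := by
    rw [nonsing_inv_nonsing_inv _ ((isUnit_iff_isUnit_det _).1 hR.isUnit), hG]
    simp only [transpose_mul, Matrix.mul_assoc]
  have hV : (batchMat A B C Q R N + obsMat A C N * B * R⁻¹ * (obsMat A C N * B)ᵀ).PosDef := by
    refine hW.add_posSemidef ?_
    simpa using hR.inv.posSemidef.mul_mul_conjTranspose_same (obsMat A C N * B)
  have hinv : ((batchMat A B C Q R (N + 1))⁻¹).submatrix (blockSucc N q) (blockSucc N q) =
      fromBlocks Q 0 0
        (batchMat A B C Q R N + obsMat A C N * B * R⁻¹ * (obsMat A C N * B)ᵀ)⁻¹ := by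
    rw [← inv_submatrix_equiv, batchMat_succ, inv_fromBlocks_zero₂₁_of_isUnit_iff _ _ _
      (iff_of_true hQ.inv.isUnit hV.isUnit),
      nonsing_inv_nonsing_inv _ ((isUnit_iff_isUnit_det _).1 hQ.isUnit)]
    simp
  have hsplit :
      (obsMat A C (N + 1))ᵀ * (batchMat A B C Q R (N + 1))⁻¹ * obsMat A C (N + 1) =
        (fromRows C (obsMat A C N * A))ᵀ * fromBlocks Q 0 0
          (batchMat A B C Q R N + obsMat A C N * B * R⁻¹ * (obsMat A C N * B)ᵀ)⁻¹ *
          fromRows C (obsMat A C N * A) := by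
    rw [← hinv, ← obsMat_succ, transpose_submatrix, submatrix_mul_equiv, submatrix_mul_equiv,
      submatrix_id_id]
  rw [hsplit, add_mul_mul_inv_eq_sub _ _ _ _ hW.isUnit hR.inv.isUnit (by rw [hK']; exact hK.isUnit),
    hK', transpose_fromRows, fromCols_mul_fromBlocks, fromCols_mul_fromRows]
  rw [add_comm]
  congr 1
  · rw [hG]
    simp only [transpose_mul, Matrix.mul_sub, Matrix.sub_mul, Matrix.mul_assoc, Matrix.mul_zero,
      zero_add]
  · simp

end BatchMat

/-- Closed-form (batch) solution of the finite-horizon Riccati recursion: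
`P_N = O_{N+1}ᵀ (Q_{N+1}⁻¹ + S_{N+1} R_{N+1}⁻¹ S_{N+1}ᵀ)⁻¹ O_{N+1}`, the inverted
matrix being symmetric positive definite. -/
theorem riccati_batch_form {n p q : ℕ}
    (A : Matrix (Fin n) (Fin n) ℝ) (B : Matrix (Fin n) (Fin p) ℝ)
    (C : Matrix (Fin q) (Fin n) ℝ)
    (Q : Matrix (Fin q) (Fin q) ℝ) (R : Matrix (Fin p) (Fin p) ℝ)
    (hQ : Q.PosDef) (hR : R.PosDef)
    (P : ℕ → Matrix (Fin n) (Fin n) ℝ)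
    (hP0 : P 0 = Cᵀ * Q * C)
    (hPrec : ∀ j, P (j + 1) =
      Aᵀ * P j * A - (Aᵀ * P j * B) * (R + Bᵀ * P j * B)⁻¹ * (Bᵀ * P j * A) + Cᵀ * Q * C)
    (N : ℕ) :
    ((blkDiag Q (N + 1))⁻¹ +
        toepMat A B C (N + 1) * (blkDiag R (N + 1))⁻¹ * (toepMat A B C (N + 1))ᵀ).PosDef ∧
      P N = (obsMat A C (N + 1))ᵀ *
          ((blkDiag Q (N + 1))⁻¹ +
            toepMat A B C (N + 1) * (blkDiag R (N + 1))⁻¹ * (toepMat A B C (N + 1))ᵀ)⁻¹ *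
          obsMat A C (N + 1) := by
  refine ⟨posDef_batchMat A B C hQ hR (N + 1), ?_⟩
  change P N = (obsMat A C (N + 1))ᵀ * (batchMat A B C Q R (N + 1))⁻¹ * obsMat A C (N + 1)
  induction N with
  | zero =>
    rw [batch_riccati_step A B C hQ hR 0 0 (by ext; simp [Matrix.mul_apply]), hP0]
    simp
  | succ N ih => rw [batch_riccati_step A B C hQ hR (N + 1) (P N) ih, hPrec]
end

section
/- Let O ∈ R^{m×n} and S ∈ R^{m×l} be arbitrary real matrices and let Q ∈ R^{m×m} and R ∈ R^{l×l} be symmetric positive definite. Then for every x ∈ R^n, the function u ↦ (Ox + Su)^T Q (Ox + Su) + u^T R u attains its unique global minimum at u* = −(R + S^T Q S)^{-1} S^T Q O x, and the minimum value equals x^T O^T (Q^{-1} + S R^{-1} S^T)^{-1} O x. -/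
open Matrix

/-- A symmetric matrix can be moved across the dot product. -/
theorem Matrix.IsSymm.dotProduct_mulVec_comm {ι α : Type*} [Fintype ι] [CommSemiring α]
    {M : Matrix ι ι α} (hM : M.IsSymm) (v w : ι → α) : v ⬝ᵥ M *ᵥ w = w ⬝ᵥ M *ᵥ v := by
  rw [dotProduct_mulVec, dotProduct_comm, ← mulVec_transpose, hM.eq]

/-- Expansion of the cost `(y + Su)ᵀ Q (y + Su) + uᵀ R u` in powers of `u`. -/
theorem quadratic_cost_expand {ι κ α : Type*} [Fintype ι] [Fintype κ] [CommRing α]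
    {Q : Matrix ι ι α} (hQ : Q.IsSymm) (R : Matrix κ κ α) (S : Matrix ι κ α)
    (y : ι → α) (u : κ → α) :
    (y + S *ᵥ u) ⬝ᵥ Q *ᵥ (y + S *ᵥ u) + u ⬝ᵥ R *ᵥ u =
      y ⬝ᵥ Q *ᵥ y + 2 * (u ⬝ᵥ (Sᵀ * Q) *ᵥ y) + u ⬝ᵥ (R + Sᵀ * Q * S) *ᵥ u := by
  have move (v : ι → α) : u ⬝ᵥ Sᵀ *ᵥ v = S *ᵥ u ⬝ᵥ v := by
    rw [dotProduct_mulVec, vecMul_transpose]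
  simp only [add_mulVec, mulVec_add, dotProduct_add, add_dotProduct, ← mulVec_mulVec, move]
  rw [hQ.dotProduct_mulVec_comm y (S *ᵥ u)]
  ring

/-- Completing the square around a stationary point `w` of `u ↦ 2 uᵀ b + uᵀ P u`. -/
theorem Matrix.IsSymm.complete_square {κ α : Type*} [Fintype κ] [CommRing α]
    {P : Matrix κ κ α} (hP : P.IsSymm) {b w : κ → α} (hw : P *ᵥ w = -b) (u : κ → α) :
    2 * (u ⬝ᵥ b) + u ⬝ᵥ P *ᵥ u = w ⬝ᵥ b + (u - w) ⬝ᵥ P *ᵥ (u - w) := by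
  simp only [mulVec_sub, dotProduct_sub, sub_dotProduct]
  rw [hP.dotProduct_mulVec_comm w u, hw]
  simp only [dotProduct_neg]
  ring

/-- One-step quadratic minimization: for symmetric positive definite `Q`, `R`, the function
`u ↦ (Ox + Su)ᵀ Q (Ox + Su) + uᵀ R u` attains its unique global minimum at
`u* = -(R + Sᵀ Q S)⁻¹ Sᵀ Q O x`, with minimum value `xᵀ Oᵀ (Q⁻¹ + S R⁻¹ Sᵀ)⁻¹ O x`. -/
theorem quadratic_min_completion {m n l : ℕ}
    (O : Matrix (Fin m) (Fin n) ℝ) (S : Matrix (Fin m) (Fin l) ℝ)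
    (Q : Matrix (Fin m) (Fin m) ℝ) (R : Matrix (Fin l) (Fin l) ℝ)
    (hQ : Q.PosDef) (hR : R.PosDef) (x : Fin n → ℝ) :
    let f : (Fin l → ℝ) → ℝ := fun u =>
      (O.mulVec x + S.mulVec u) ⬝ᵥ Q.mulVec (O.mulVec x + S.mulVec u) + u ⬝ᵥ R.mulVec u
    let ustar : Fin l → ℝ := -(((R + Sᵀ * Q * S)⁻¹ * (Sᵀ * Q * O)).mulVec x)
    (∀ u : Fin l → ℝ, u ≠ ustar → f ustar < f u) ∧
      f ustar = x ⬝ᵥ ((Oᵀ * (Q⁻¹ + S * R⁻¹ * Sᵀ)⁻¹ * O).mulVec x) := by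
  intro f ustar
  have hQs : Q.IsSymm := hQ.isHermitian
  have hP : (R + Sᵀ * Q * S).PosDef :=
    hR.add_posSemidef (hQ.posSemidef.conjTranspose_mul_mul_same S)
  have hPs : (R + Sᵀ * Q * S).IsSymm := hP.isHermitian
  have hPdet : IsUnit (R + Sᵀ * Q * S).det := (isUnit_iff_isUnit_det _).1 hP.isUnit
  have hQdet : IsUnit Q.det := (isUnit_iff_isUnit_det _).1 hQ.isUnit
  have hRdet : IsUnit R.det := (isUnit_iff_isUnit_det _).1 hR.isUnit
  have hw : (R + Sᵀ * Q * S) *ᵥ ustar = -((Sᵀ * Q) *ᵥ (O *ᵥ x)) := by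
    simp only [ustar]
    rw [mulVec_neg, mulVec_mulVec, mul_nonsing_inv_cancel_left _ _ hPdet, mulVec_mulVec]
  have hf (u : Fin l → ℝ) : f u = O *ᵥ x ⬝ᵥ Q *ᵥ (O *ᵥ x) + ustar ⬝ᵥ (Sᵀ * Q) *ᵥ (O *ᵥ x) +
      (u - ustar) ⬝ᵥ (R + Sᵀ * Q * S) *ᵥ (u - ustar) := by
    rw [add_assoc, ← hPs.complete_square hw u, ← add_assoc]
    exact quadratic_cost_expand hQs R S (O *ᵥ x) u
  refine ⟨fun u hu => ?_, ?_⟩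
  · have hpos := hP.dotProduct_mulVec_pos (sub_ne_zero.2 hu)
    rw [star_trivial] at hpos
    rw [hf u, hf ustar, sub_self, zero_dotProduct]
    linarith
  · have hinv : (Q⁻¹ + S * R⁻¹ * Sᵀ)⁻¹ = Q - Q * S * (R + Sᵀ * Q * S)⁻¹ * Sᵀ * Q := by
      rw [add_mul_mul_inv_eq_sub _ _ _ _ hQ.inv.isUnit hR.inv.isUnit] <;>
        simp only [nonsing_inv_nonsing_inv _ hQdet, nonsing_inv_nonsing_inv _ hRdet]
      exact hP.isUnit
    have hstar : ustar = -((R + Sᵀ * Q * S)⁻¹ *ᵥ ((Sᵀ * Q) *ᵥ (O *ᵥ x))) := by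
      simp only [ustar, mulVec_mulVec, Matrix.mul_assoc]
    have hcross : O *ᵥ x ⬝ᵥ (Q * S) *ᵥ ustar = ustar ⬝ᵥ (Sᵀ * Q) *ᵥ (O *ᵥ x) := by
      rw [dotProduct_mulVec, ← mulVec_transpose, transpose_mul, hQs.eq, dotProduct_comm]
    have hval (M : Matrix (Fin m) (Fin m) ℝ) :
        x ⬝ᵥ (Oᵀ * M * O) *ᵥ x = O *ᵥ x ⬝ᵥ M *ᵥ (O *ᵥ x) := by
      rw [← mulVec_mulVec, ← mulVec_mulVec, dotProduct_mulVec, vecMul_transpose]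
    rw [hf ustar, sub_self, zero_dotProduct, add_zero, hinv, ← hcross, hstar, hval, sub_mulVec,
      dotProduct_sub, mulVec_neg, dotProduct_neg, ← sub_eq_add_neg]
    simp only [mulVec_mulVec, Matrix.mul_assoc]
end

section
/- For the system x(k+1) = A x(k) + B u(k), y(k) = C x(k) with fixed initial state x(0), and for the finite-horizon cost J_N(u) = Σ_{k=0}^{N−1} (y(k)^T Q y(k) + u(k)^T R u(k)) + y(N)^T Q y(N), every input sequence u(0), …, u(N−1) satisfies J_N(u) ≥ x(0)^T P_N x(0), with equality if and only if u(k) = −(R + B^T P_{N−1−k} B)^{-1} B^T P_{N−1−k} A x(k) for all k = 0, …, N−1. In particular, the minimum finite-horizon LQR cost equals x(0)^T P_N x(0) and is achieved by the time-varying state feedback given by the Riccati iterates. -/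
open Matrix Finset

/-- Completing the square for a symmetric invertible matrix `M`. -/
lemma dotProduct_mulVec_add_inv_mulVec {ι : Type*} [Fintype ι] [DecidableEq ι]
    {M : Matrix ι ι ℝ} (hM : Mᵀ = M) (hdet : IsUnit M.det) (u g : ι → ℝ) :
    (u + M⁻¹ *ᵥ g) ⬝ᵥ M *ᵥ (u + M⁻¹ *ᵥ g) =
      u ⬝ᵥ M *ᵥ u + 2 * (u ⬝ᵥ g) + g ⬝ᵥ M⁻¹ *ᵥ g := by
  have hinv : M *ᵥ M⁻¹ *ᵥ g = g := by
    rw [mulVec_mulVec, mul_nonsing_inv _ hdet, one_mulVec]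
  have hsymm : (M⁻¹ *ᵥ g) ⬝ᵥ M *ᵥ u = u ⬝ᵥ g := by
    rw [dotProduct_mulVec, ← mulVec_transpose, hM, hinv, dotProduct_comm]
  rw [mulVec_add, hinv, add_dotProduct, dotProduct_add, dotProduct_add, hsymm,
    dotProduct_comm (M⁻¹ *ᵥ g) g]
  ring

section Riccati

variable {n p : Type*} [Fintype n] [Fintype p] [DecidableEq p]

/-- The one-step cost-to-go is its minimum over the input plus a square. -/
lemma lqr_one_step {A P : Matrix n n ℝ} {B : Matrix n p ℝ} {R : Matrix p p ℝ}
    (hP : P.PosSemidef) (hR : R.PosDef) (x : n → ℝ) (u : p → ℝ) :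
    u ⬝ᵥ R *ᵥ u + (A *ᵥ x + B *ᵥ u) ⬝ᵥ P *ᵥ (A *ᵥ x + B *ᵥ u) =
      x ⬝ᵥ (Aᵀ * P * A -
        (Aᵀ * P * B) * (R + Bᵀ * P * B)⁻¹ * (Bᵀ * P * A)) *ᵥ x +
      (u + ((R + Bᵀ * P * B)⁻¹ * (Bᵀ * P * A)) *ᵥ x) ⬝ᵥ
        (R + Bᵀ * P * B) *ᵥ (u + ((R + Bᵀ * P * B)⁻¹ * (Bᵀ * P * A)) *ᵥ x) := by
  have hM : (R + Bᵀ * P * B).PosDef :=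
    hR.add_posSemidef (by simpa using hP.conjTranspose_mul_mul_same B)
  have hPt : Pᵀ = P := by simpa using hP.isHermitian.eq
  have hMt : (R + Bᵀ * P * B)ᵀ = R + Bᵀ * P * B := by simpa using hM.isHermitian.eq
  have hcross : ∀ w : p → ℝ,
      x ⬝ᵥ (Aᵀ * P * B) *ᵥ w = ((Bᵀ * P * A) *ᵥ x) ⬝ᵥ w := by
    intro w
    rw [dotProduct_mulVec, ← mulVec_transpose]
    simp only [transpose_mul, transpose_transpose, hPt, Matrix.mul_assoc]
  have hAB : (A *ᵥ x) ⬝ᵥ P *ᵥ B *ᵥ u = u ⬝ᵥ (Bᵀ * P * A) *ᵥ x := by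
    rw [dotProduct_comm u, ← hcross, Matrix.mul_assoc, ← mulVec_mulVec, dotProduct_mulVec x,
      vecMul_transpose, mulVec_mulVec]
  have hBA : (B *ᵥ u) ⬝ᵥ P *ᵥ A *ᵥ x = u ⬝ᵥ (Bᵀ * P * A) *ᵥ x := by
    rw [Matrix.mul_assoc, ← mulVec_mulVec, dotProduct_mulVec u, vecMul_transpose, mulVec_mulVec]
  have hAA : (A *ᵥ x) ⬝ᵥ P *ᵥ A *ᵥ x = x ⬝ᵥ (Aᵀ * P * A) *ᵥ x := by
    rw [Matrix.mul_assoc, ← mulVec_mulVec, dotProduct_mulVec x, vecMul_transpose, mulVec_mulVec]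
  have hBB : (B *ᵥ u) ⬝ᵥ P *ᵥ B *ᵥ u = u ⬝ᵥ (Bᵀ * P * B) *ᵥ u := by
    rw [Matrix.mul_assoc, ← mulVec_mulVec, dotProduct_mulVec u, vecMul_transpose, mulVec_mulVec]
  rw [← mulVec_mulVec x (R + Bᵀ * P * B)⁻¹,
    dotProduct_mulVec_add_inv_mulVec hMt hM.det_pos.ne'.isUnit, sub_mulVec, dotProduct_sub,
    Matrix.mul_assoc (Aᵀ * P * B), ← mulVec_mulVec x (Aᵀ * P * B), hcross, ← mulVec_mulVec x (_⁻¹),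
    mulVec_add, add_dotProduct, dotProduct_add, dotProduct_add, hAB, hBA, hAA, hBB,
    add_mulVec R, dotProduct_add]
  ring

/-- The Schur complement in the Riccati recursion is positive semidefinite. -/
lemma posSemidef_riccati_schur {A P : Matrix n n ℝ} {B : Matrix n p ℝ} {R : Matrix p p ℝ}
    (hP : P.PosSemidef) (hR : R.PosDef) :
    (Aᵀ * P * A - (Aᵀ * P * B) * (R + Bᵀ * P * B)⁻¹ * (Bᵀ * P * A)).PosSemidef := by
  refine PosSemidef.of_dotProduct_mulVec_nonneg ?_ fun x => ?_
  · have hM : (R + Bᵀ * P * B).PosDef :=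
      hR.add_posSemidef (by simpa using hP.conjTranspose_mul_mul_same B)
    have hPt : Pᵀ = P := by simpa using hP.isHermitian.eq
    have hMt : (R + Bᵀ * P * B)ᵀ = R + Bᵀ * P * B := by simpa using hM.isHermitian.eq
    rw [IsHermitian, conjTranspose_eq_transpose_of_trivial, transpose_sub, transpose_mul _ (Bᵀ * P * A),
      transpose_mul _ (_⁻¹), transpose_nonsing_inv, hMt]
    simp only [transpose_mul, transpose_transpose, hPt, Matrix.mul_assoc]
  · have h := lqr_one_step (A := A) (B := B) hP hR x
      (-(((R + Bᵀ * P * B)⁻¹ * (Bᵀ * P * A)) *ᵥ x))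
    rw [neg_add_cancel, zero_dotProduct, add_zero] at h
    rw [star_trivial, ← h]
    exact add_nonneg (hR.posSemidef.dotProduct_mulVec_nonneg _)
      (hP.dotProduct_mulVec_nonneg _)

end Riccati

/-- Finite-horizon LQR optimality: for the system `x(k+1) = A x(k) + B u(k)`,
`y(k) = C x(k)`, the cost
`J_N(u) = Σ_{k=0}^{N-1} (y(k)ᵀ Q y(k) + u(k)ᵀ R u(k)) + y(N)ᵀ Q y(N)`
satisfies `J_N(u) ≥ x(0)ᵀ P_N x(0)`, with equality iff
`u(k) = -(R + Bᵀ P_{N-1-k} B)⁻¹ Bᵀ P_{N-1-k} A x(k)` for all `k < N`,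
where `P_j` are the Riccati iterates. -/
theorem finite_horizon_lqr_optimality {n p q : ℕ}
    (A : Matrix (Fin n) (Fin n) ℝ) (B : Matrix (Fin n) (Fin p) ℝ)
    (C : Matrix (Fin q) (Fin n) ℝ)
    (Q : Matrix (Fin q) (Fin q) ℝ) (R : Matrix (Fin p) (Fin p) ℝ)
    (hQ : Q.PosDef) (hR : R.PosDef)
    (P : ℕ → Matrix (Fin n) (Fin n) ℝ)
    (hP0 : P 0 = Cᵀ * Q * C)
    (hPrec : ∀ j, P (j + 1) =
      Aᵀ * P j * A - (Aᵀ * P j * B) * (R + Bᵀ * P j * B)⁻¹ * (Bᵀ * P j * A) + Cᵀ * Q * C)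
    (N : ℕ)
    (x : ℕ → Fin n → ℝ) (u : ℕ → Fin p → ℝ) (y : ℕ → Fin q → ℝ)
    (hdyn : ∀ k, x (k + 1) = A.mulVec (x k) + B.mulVec (u k))
    (hout : ∀ k, y k = C.mulVec (x k)) :
    let J : ℝ := (∑ k ∈ range N, (y k ⬝ᵥ Q.mulVec (y k) + u k ⬝ᵥ R.mulVec (u k))) +
      y N ⬝ᵥ Q.mulVec (y N)
    J ≥ x 0 ⬝ᵥ (P N).mulVec (x 0) ∧
      (J = x 0 ⬝ᵥ (P N).mulVec (x 0) ↔
        ∀ k < N, u k =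
          -(((R + Bᵀ * P (N - 1 - k) * B)⁻¹ * (Bᵀ * P (N - 1 - k) * A)).mulVec (x k))) := by
  have hCQC : (Cᵀ * Q * C).PosSemidef := by
    simpa using hQ.posSemidef.conjTranspose_mul_mul_same C
  have hP : ∀ j, (P j).PosSemidef := by
    intro j
    induction j with
    | zero => rwa [hP0]
    | succ j ih =>
      rw [hPrec]
      exact (posSemidef_riccati_schur ih hR).add hCQC
  have hM : ∀ j, (R + Bᵀ * P j * B).PosDef := fun j =>
    hR.add_posSemidef (by simpa using (hP j).conjTranspose_mul_mul_same B)
  have hy : ∀ k, y k ⬝ᵥ Q *ᵥ y k = x k ⬝ᵥ (Cᵀ * Q * C) *ᵥ x k := by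
    intro k
    rw [hout, Matrix.mul_assoc, ← mulVec_mulVec, dotProduct_mulVec (x k), vecMul_transpose,
      mulVec_mulVec]
  let w : ℕ → Fin p → ℝ := fun k =>
    u k + ((R + Bᵀ * P (N - 1 - k) * B)⁻¹ * (Bᵀ * P (N - 1 - k) * A)) *ᵥ x k
  let S : ℕ → ℝ := fun k => w k ⬝ᵥ (R + Bᵀ * P (N - 1 - k) * B) *ᵥ w k
  have hstage : ∀ k ∈ range N, y k ⬝ᵥ Q *ᵥ y k + u k ⬝ᵥ R *ᵥ u k =
      (x k ⬝ᵥ P (N - k) *ᵥ x k - x (k + 1) ⬝ᵥ P (N - (k + 1)) *ᵥ x (k + 1)) + S k := by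
    intro k hk
    have hk' : k < N := mem_range.mp hk
    have h := lqr_one_step (A := A) (B := B) (hP (N - 1 - k)) hR (x k) (u k)
    rw [← hdyn] at h
    rw [show N - (k + 1) = N - 1 - k by omega, show N - k = N - 1 - k + 1 by omega, hPrec,
      add_mulVec, dotProduct_add, hy]
    simp only [S, w]
    linarith
  have hJ : (∑ k ∈ range N, (y k ⬝ᵥ Q *ᵥ y k + u k ⬝ᵥ R *ᵥ u k)) + y N ⬝ᵥ Q *ᵥ y N =
      x 0 ⬝ᵥ P N *ᵥ x 0 + ∑ k ∈ range N, S k := by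
    rw [sum_congr rfl hstage, sum_add_distrib,
      sum_range_sub' (fun k => x k ⬝ᵥ P (N - k) *ᵥ x k), hy, ← hP0]
    simp only [Nat.sub_self, Nat.sub_zero]
    ring
  have hS : ∀ k ∈ range N, 0 ≤ S k := fun k _ => by
    simpa using (hM (N - 1 - k)).posSemidef.dotProduct_mulVec_nonneg (w k)
  have hS0 : ∀ k, S k = 0 ↔ w k = 0 := by
    refine fun k => ⟨fun h => ?_, fun h => by simp [S, h]⟩
    by_contra hne
    have := (hM (N - 1 - k)).dotProduct_mulVec_pos hne
    rw [star_trivial] at this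
    exact this.ne' h
  intro J
  refine ⟨?_, ?_⟩
  · simpa only [J, hJ, ge_iff_le, le_add_iff_nonneg_right] using sum_nonneg hS
  · simp only [J, hJ, add_eq_left, sum_eq_zero_iff_of_nonneg hS, mem_range, hS0, w,
      add_eq_zero_iff_eq_neg]
end

section
/- Let u, y, x satisfy x(k+1) = A x(k) + B u(k), y(k) = C x(k) for all k, and suppose F ∈ R^{n×qN} satisfies A^N + F O_N = 0. Then the future Hankel output matrix admits the state-free predictor representation Y_f = O_N (C_N + F S_N) U_p − O_N F Y_p + S_N U_f, where C_N = [A^{N−1}B A^{N−2}B ⋯ B], U_p = H_{N,L}(u(0)), Y_p = H_{N,L}(y(0)), U_f = H_{N,L}(u(N)), and Y_f = H_{N,L}(y(N)). -/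
open Matrix

/-- Extended controllability-type matrix `C_N = [A^{N-1}B ⋯ AB B]`. -/
def ctrlMat {n p : ℕ} (A : Matrix (Fin n) (Fin n) ℝ) (B : Matrix (Fin n) (Fin p) ℝ)
    (N : ℕ) : Matrix (Fin n) (Fin N × Fin p) ℝ :=
  fun i jb => (A ^ (N - 1 - (jb.1 : ℕ)) * B) i jb.2

/-- Block Hankel matrix of a signal `e`, starting at time `k`, with `N` block rows and `L`
columns: its block `(i,j)` (0-based) is `e (k + i + j)`. -/
def hankelMat {d : ℕ} (e : ℕ → Fin d → ℝ) (k N L : ℕ) : Matrix (Fin N × Fin d) (Fin L) ℝ :=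
  fun ia j => e (k + (ia.1 : ℕ) + (j : ℕ)) ia.2

/-- Matrix whose `j`-th column (0-based) is the state `x (k + j)`. -/
def stateMat {n : ℕ} (x : ℕ → Fin n → ℝ) (k L : ℕ) : Matrix (Fin n) (Fin L) ℝ :=
  fun i j => x (k + j) i

/-- Variation of constants formula for `x (k + 1) = A x k + B u k`. -/
theorem state_add_eq {n p : ℕ} {A : Matrix (Fin n) (Fin n) ℝ} {B : Matrix (Fin n) (Fin p) ℝ}
    {x : ℕ → Fin n → ℝ} {u : ℕ → Fin p → ℝ}
    (hdyn : ∀ k, x (k + 1) = A.mulVec (x k) + B.mulVec (u k)) (k m : ℕ) :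
    x (k + m) = (A ^ m).mulVec (x k) +
      ∑ j ∈ Finset.range m, (A ^ (m - 1 - j) * B).mulVec (u (k + j)) := by
  induction m with
  | zero => simp
  | succ m ih =>
    rw [← add_assoc, hdyn, ih, Finset.sum_range_succ, mulVec_add, mulVec_mulVec, ← pow_succ',
      mulVec_sum, add_assoc]
    congr 2
    · refine Finset.sum_congr rfl fun j hj => ?_
      have hj' := Finset.mem_range.mp hj
      rw [mulVec_mulVec, ← Matrix.mul_assoc, ← pow_succ']
      congr 3
      omega
    · simp

/-- The states `N` steps ahead in terms of the current states and the inputs. -/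
theorem stateMat_add {n p : ℕ} {A : Matrix (Fin n) (Fin n) ℝ} {B : Matrix (Fin n) (Fin p) ℝ}
    {x : ℕ → Fin n → ℝ} {u : ℕ → Fin p → ℝ}
    (hdyn : ∀ k, x (k + 1) = A.mulVec (x k) + B.mulVec (u k)) (k N L : ℕ) :
    stateMat x (k + N) L = A ^ N * stateMat x k L + ctrlMat A B N * hankelMat u k N L := by
  ext i j
  have h := congrFun (state_add_eq hdyn (k + j) N) i
  rw [← Fin.sum_univ_eq_sum_range
    (fun l => (A ^ (N - 1 - l) * B).mulVec (u (k + j + l))) N] at h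
  simp only [Pi.add_apply, Finset.sum_apply] at h
  simp only [stateMat, Matrix.add_apply, Matrix.mul_apply (M := A ^ N),
    Matrix.mul_apply (M := ctrlMat A B N), Fintype.sum_prod_type, ctrlMat, hankelMat]
  rw [add_right_comm, h]
  simp only [mulVec, dotProduct, add_right_comm k]

/-- The Hankel matrix of the outputs in terms of the states and the inputs. -/
theorem hankelMat_output {n p q : ℕ} {A : Matrix (Fin n) (Fin n) ℝ}
    {B : Matrix (Fin n) (Fin p) ℝ} {C : Matrix (Fin q) (Fin n) ℝ}
    {x : ℕ → Fin n → ℝ} {u : ℕ → Fin p → ℝ} {y : ℕ → Fin q → ℝ}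
    (hdyn : ∀ k, x (k + 1) = A.mulVec (x k) + B.mulVec (u k))
    (hout : ∀ k, y k = C.mulVec (x k)) (k N L : ℕ) :
    hankelMat y k N L =
      obsMat A C N * stateMat x k L + toepMat A B C N * hankelMat u k N L := by
  ext ⟨i, a⟩ j
  have h := congrFun (congrArg C.mulVec (state_add_eq hdyn (k + j) i)) a
  rw [mulVec_add, mulVec_sum, mulVec_mulVec] at h
  simp only [mulVec_mulVec, ← Matrix.mul_assoc, Pi.add_apply, Finset.sum_apply] at h
  simp only [stateMat, Matrix.add_apply, Matrix.mul_apply (M := obsMat A C N),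
    Matrix.mul_apply (M := toepMat A B C N), Fintype.sum_prod_type, obsMat, toepMat, hankelMat]
  rw [hout, add_right_comm, h]
  congr 1
  have hr : Finset.range (i : ℕ) = (Finset.range N).filter (· < (i : ℕ)) := by
    ext l
    simp only [Finset.mem_range, Finset.mem_filter]
    omega
  rw [hr, Finset.sum_filter, ← Fin.sum_univ_eq_sum_range (fun l => if l < (i : ℕ) then
    (C * A ^ ((i : ℕ) - 1 - l) * B).mulVec (u (k + j + l)) a else 0) N]
  refine Finset.sum_congr rfl fun l _ => ?_
  split_ifs
  · simp only [mulVec, dotProduct, add_right_comm k, Nat.sub_right_comm]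
  · simp

/-- State-free predictor representation of the future Hankel outputs:
if `A^N + F O_N = 0`, then `Y_f = O_N (C_N + F S_N) U_p - O_N F Y_p + S_N U_f`. -/
theorem state_free_predictor {n p q : ℕ}
    (A : Matrix (Fin n) (Fin n) ℝ) (B : Matrix (Fin n) (Fin p) ℝ)
    (C : Matrix (Fin q) (Fin n) ℝ)
    (x : ℕ → Fin n → ℝ) (u : ℕ → Fin p → ℝ) (y : ℕ → Fin q → ℝ)
    (hdyn : ∀ k, x (k + 1) = A.mulVec (x k) + B.mulVec (u k))
    (hout : ∀ k, y k = C.mulVec (x k))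
    (N L : ℕ) (hN : 1 ≤ N) (hL : 1 ≤ L)
    (F : Matrix (Fin n) (Fin N × Fin q) ℝ)
    (hF : A ^ N + F * obsMat A C N = 0) :
    hankelMat y N N L =
      obsMat A C N * (ctrlMat A B N + F * toepMat A B C N) * hankelMat u 0 N L -
        obsMat A C N * F * hankelMat y 0 N L +
        toepMat A B C N * hankelMat u N N L := by
  have hA : A ^ N = -(F * obsMat A C N) := eq_neg_of_add_eq_zero_left hF
  have hX := stateMat_add hdyn 0 N L
  rw [zero_add, hA] at hX
  rw [hankelMat_output hdyn hout N N L, hX, hankelMat_output hdyn hout 0 N L]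
  simp only [Matrix.mul_add, Matrix.add_mul, Matrix.neg_mul, Matrix.mul_neg, Matrix.mul_assoc]
  abel
end
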